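/- Along any trajectory of the mechanical system with inner-loop control u(t) := τ(t) − ∇V_a(q_a(t)), the storage function H_a satisfies d/dt H_a(q_u(t), q̇(t)) = u(t)ᵀ y_a(t) for all t ≥ 0; consequently, since M_a(q_u) is positive semidefinite so that H_a ≥ 0, the map u ↦ y_a is passive: ∫₀ᵗ u(s)ᵀ y_a(s) ds ≥ −H_a(q_u(0), q̇(0)) for all t ≥ 0. (Proposition 1, actuated output.) -/

import Mathlib

open Matrix Set Filter

noncomputable section

/-- Componentwise gradient of a scalar function on `Fin k → ℝ`. -/
def grad {k : ℕ} (f : (Fin k → ℝ) → ℝ) (x : Fin k → ℝ) : Fin k → ℝ :=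
  fun i => fderiv ℝ f x (Pi.single i 1)

/-- The block inertia matrix `M(q_u) = [[m_uu, m_auᵀ], [m_au, m_aa]]`. -/
def Mblk {s m : ℕ} (muu : (Fin s → ℝ) → Matrix (Fin s) (Fin s) ℝ)
    (mau : (Fin s → ℝ) → Matrix (Fin m) (Fin s) ℝ)
    (maa : Matrix (Fin m) (Fin m) ℝ) (qu : Fin s → ℝ) :
    Matrix (Fin s ⊕ Fin m) (Fin s ⊕ Fin m) ℝ :=
  Matrix.fromBlocks (muu qu) (mau qu)ᵀ (mau qu) maa

/-- The Jacobian `J(q, v)` (w.r.t. `q`) of the map `q ↦ M(q_u) v`. -/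
def Jmat {s m : ℕ} (muu : (Fin s → ℝ) → Matrix (Fin s) (Fin s) ℝ)
    (mau : (Fin s → ℝ) → Matrix (Fin m) (Fin s) ℝ)
    (maa : Matrix (Fin m) (Fin m) ℝ)
    (q v : (Fin s ⊕ Fin m) → ℝ) :
    Matrix (Fin s ⊕ Fin m) (Fin s ⊕ Fin m) ℝ :=
  fun i j =>
    fderiv ℝ (fun p : (Fin s ⊕ Fin m) → ℝ =>
      (Mblk muu mau maa (p ∘ Sum.inl) *ᵥ v) i) q (Pi.single j 1)

/-- The Coriolis force vector `C(q, q̇) q̇ = [J(q,q̇) − ½ J(q,q̇)ᵀ] q̇`. -/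
def Cvec {s m : ℕ} (muu : (Fin s → ℝ) → Matrix (Fin s) (Fin s) ℝ)
    (mau : (Fin s → ℝ) → Matrix (Fin m) (Fin s) ℝ)
    (maa : Matrix (Fin m) (Fin m) ℝ)
    (q v : (Fin s ⊕ Fin m) → ℝ) : (Fin s ⊕ Fin m) → ℝ :=
  (Jmat muu mau maa q v - (1/2 : ℝ) • (Jmat muu mau maa q v)ᵀ) *ᵥ v

/-- The Schur complement `m_uu^s(q_u) = m_uu − m_auᵀ m_aa⁻¹ m_au`. -/
def muuS {s m : ℕ} (muu : (Fin s → ℝ) → Matrix (Fin s) (Fin s) ℝ)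
    (mau : (Fin s → ℝ) → Matrix (Fin m) (Fin s) ℝ)
    (maa : Matrix (Fin m) (Fin m) ℝ) (qu : Fin s → ℝ) : Matrix (Fin s) (Fin s) ℝ :=
  muu qu - (mau qu)ᵀ * maa⁻¹ * mau qu

/-- `M_a(q_u) = [[m_auᵀ m_aa⁻¹ m_au, m_auᵀ], [m_au, m_aa]]`. -/
def MaMat {s m : ℕ} (mau : (Fin s → ℝ) → Matrix (Fin m) (Fin s) ℝ)
    (maa : Matrix (Fin m) (Fin m) ℝ) (qu : Fin s → ℝ) :
    Matrix (Fin s ⊕ Fin m) (Fin s ⊕ Fin m) ℝ :=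
  Matrix.fromBlocks ((mau qu)ᵀ * maa⁻¹ * mau qu) (mau qu)ᵀ (mau qu) maa

/-- Storage function `H_u(q_u, q̇_u) = ½ q̇_uᵀ m_uu^s(q_u) q̇_u + V_u(q_u)`. -/
def Hu {s m : ℕ} (muu : (Fin s → ℝ) → Matrix (Fin s) (Fin s) ℝ)
    (mau : (Fin s → ℝ) → Matrix (Fin m) (Fin s) ℝ)
    (maa : Matrix (Fin m) (Fin m) ℝ) (Vu : (Fin s → ℝ) → ℝ)
    (qu vu : Fin s → ℝ) : ℝ :=
  (1/2 : ℝ) * (vu ⬝ᵥ muuS muu mau maa qu *ᵥ vu) + Vu qu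

/-- Storage function `H_a(q_u, q̇) = ½ q̇ᵀ M_a(q_u) q̇`. -/
def Ha {s m : ℕ} (mau : (Fin s → ℝ) → Matrix (Fin m) (Fin s) ℝ)
    (maa : Matrix (Fin m) (Fin m) ℝ) (qu : Fin s → ℝ)
    (qdot : (Fin s ⊕ Fin m) → ℝ) : ℝ :=
  (1/2 : ℝ) * (qdot ⬝ᵥ MaMat mau maa qu *ᵥ qdot)

/-- Passive output `y_u = −m_aa⁻¹ m_au(q_u) q̇_u`. -/
def yU {s m : ℕ} (mau : (Fin s → ℝ) → Matrix (Fin m) (Fin s) ℝ)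
    (maa : Matrix (Fin m) (Fin m) ℝ) (qu vu : Fin s → ℝ) : Fin m → ℝ :=
  -(maa⁻¹ *ᵥ (mau qu *ᵥ vu))

/-- Passive output `y_a = m_aa⁻¹ m_au(q_u) q̇_u + q̇_a`. -/
def yA {s m : ℕ} (mau : (Fin s → ℝ) → Matrix (Fin m) (Fin s) ℝ)
    (maa : Matrix (Fin m) (Fin m) ℝ) (qu vu : Fin s → ℝ) (va : Fin m → ℝ) : Fin m → ℝ :=
  maa⁻¹ *ᵥ (mau qu *ᵥ vu) + va

section Blocks

variable {s m : ℕ} {muu : (Fin s → ℝ) → Matrix (Fin s) (Fin s) ℝ}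
  {mau : (Fin s → ℝ) → Matrix (Fin m) (Fin s) ℝ} {maa : Matrix (Fin m) (Fin m) ℝ}

lemma posDef_of_Mblk_posDef {qu : Fin s → ℝ} (hM : (Mblk muu mau maa qu).PosDef) :
    maa.PosDef :=
  hM.submatrix Sum.inr_injective

lemma MaMat_posSemidef (hmaa : maa.PosDef) (qu : Fin s → ℝ) :
    (MaMat mau maa qu).PosSemidef := by
  have := hmaa.isUnit.invertible
  have h := (PosDef.fromBlocks₂₂ ((mau qu)ᵀ * maa⁻¹ * mau qu) (mau qu)ᵀ hmaa).2
    (by simpa using PosSemidef.zero)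
  simpa [MaMat] using h

lemma Ha_nonneg (hmaa : maa.PosDef) (qu : Fin s → ℝ) (v : Fin s ⊕ Fin m → ℝ) :
    0 ≤ Ha mau maa qu v := by
  have h := (MaMat_posSemidef (mau := mau) hmaa qu).dotProduct_mulVec_nonneg v
  rw [star_trivial] at h
  unfold Ha
  positivity

/-- The storage function is the kinetic energy of the output `y_a`. -/
lemma Ha_eq_yA (hsymm : maa.IsSymm) (hdet : IsUnit maa.det) (qu : Fin s → ℝ)
    (v : Fin s ⊕ Fin m → ℝ) :
    Ha mau maa qu v = (1 / 2 : ℝ) *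
      (yA mau maa qu (v ∘ Sum.inl) (v ∘ Sum.inr) ⬝ᵥ
        maa *ᵥ yA mau maa qu (v ∘ Sum.inl) (v ∘ Sum.inr)) := by
  have hcancel : ∀ w : Fin m → ℝ, maa *ᵥ (maa⁻¹ *ᵥ w) = w := fun w => by
    rw [mulVec_mulVec, mul_nonsing_inv _ hdet, one_mulVec]
  have hswap : ∀ w w' : Fin m → ℝ, (maa⁻¹ *ᵥ w) ⬝ᵥ (maa *ᵥ w') = w ⬝ᵥ w' := fun w w' => by
    have h := dotProduct_transpose_mulVec maa (maa⁻¹ *ᵥ w) w'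
    rw [hsymm.eq, hcancel] at h
    rw [h, dotProduct_comm]
  have hv : v = Sum.elim (v ∘ Sum.inl) (v ∘ Sum.inr) := (Sum.elim_comp_inl_inr v).symm
  unfold Ha MaMat yA
  rw [fromBlocks_mulVec]
  conv_lhs => enter [2, 1]; rw [hv]
  rw [sumElim_dotProduct_sumElim]
  generalize v ∘ Sum.inl = a
  generalize v ∘ Sum.inr = b
  simp only [mulVec_add, dotProduct_add, add_dotProduct, hcancel, hswap, ← mulVec_mulVec,
    dotProduct_transpose_mulVec]
  rw [dotProduct_comm (maa⁻¹ *ᵥ _), dotProduct_comm b (mau qu *ᵥ a)]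

/-- The actuated block of the generalized momentum `M(q_u) q̇` is `m_aa y_a`. -/
lemma mulVec_yA (hdet : IsUnit maa.det) (qu : Fin s → ℝ) (v : Fin s ⊕ Fin m → ℝ) :
    maa *ᵥ yA mau maa qu (v ∘ Sum.inl) (v ∘ Sum.inr) =
      fun i => (Mblk muu mau maa qu *ᵥ v) (Sum.inr i) := by
  ext i
  simp [yA, Mblk, fromBlocks_mulVec, mulVec_add, mulVec_mulVec, mul_nonsing_inv_cancel_left _ _ hdet]

lemma differentiable_Mblk (hmuu : ∀ i j, Differentiable ℝ fun x => muu x i j)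
    (hmau : ∀ i j, Differentiable ℝ fun x => mau x i j) (i j : Fin s ⊕ Fin m) :
    Differentiable ℝ fun x => Mblk muu mau maa x i j := by
  rcases i with i | i <;> rcases j with j | j
  · exact hmuu i j
  · exact hmau j i
  · exact hmau i j
  · exact differentiable_const _

/-- The restriction of a configuration to its unactuated coordinates, as a linear map. -/
def unactuatedCLM (s m : ℕ) : (Fin s ⊕ Fin m → ℝ) →L[ℝ] (Fin s → ℝ) :=
  ContinuousLinearMap.pi fun i => ContinuousLinearMap.proj (Sum.inl i)

lemma hasFDerivAt_Mblk_mulVec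
    (hd : ∀ i j, Differentiable ℝ fun x => Mblk muu mau maa x i j)
    (q v : Fin s ⊕ Fin m → ℝ) (i : Fin s ⊕ Fin m) :
    HasFDerivAt (fun p : Fin s ⊕ Fin m → ℝ => (Mblk muu mau maa (p ∘ Sum.inl) *ᵥ v) i)
      (∑ j, v j • (fderiv ℝ (fun x => Mblk muu mau maa x i j) (q ∘ Sum.inl)).comp
        (unactuatedCLM s m)) q := by
  simp only [mulVec, dotProduct]
  refine HasFDerivAt.fun_sum fun j _ => HasFDerivAt.mul_const ?_ (v j)
  exact (hd i j (q ∘ Sum.inl)).hasFDerivAt.comp q (unactuatedCLM s m).hasFDerivAt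

lemma Jmat_inr (hd : ∀ i j, Differentiable ℝ fun x => Mblk muu mau maa x i j)
    (q v : Fin s ⊕ Fin m → ℝ) (i : Fin s ⊕ Fin m) (k : Fin m) :
    Jmat muu mau maa q v i (Sum.inr k) = 0 := by
  have h0 : unactuatedCLM s m (Pi.single (Sum.inr k) 1) = 0 := by
    ext j
    simp [unactuatedCLM]
  simp [Jmat, (hasFDerivAt_Mblk_mulVec hd q v i).fderiv, h0]

lemma Jmat_mulVec (hd : ∀ i j, Differentiable ℝ fun x => Mblk muu mau maa x i j)
    (q v w : Fin s ⊕ Fin m → ℝ) (i : Fin s ⊕ Fin m) :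
    (Jmat muu mau maa q v *ᵥ w) i =
      ∑ j, v j * fderiv ℝ (fun x => Mblk muu mau maa x i j) (q ∘ Sum.inl) (w ∘ Sum.inl) := by
  have h := LinearMap.pi_apply_eq_sum_univ
    (fderiv ℝ (fun p : Fin s ⊕ Fin m → ℝ =>
      (Mblk muu mau maa (p ∘ Sum.inl) *ᵥ v) i) q).toLinearMap w
  have hJ : (Jmat muu mau maa q v *ᵥ w) i = fderiv ℝ (fun p : Fin s ⊕ Fin m → ℝ =>
      (Mblk muu mau maa (p ∘ Sum.inl) *ᵥ v) i) q w := by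
    refine Eq.trans ?_ h.symm
    rw [mulVec, dotProduct]
    refine Finset.sum_congr rfl fun j _ => ?_
    rw [smul_eq_mul, mul_comm]
    have he : (fun k => if j = k then (1 : ℝ) else 0) = Pi.single j 1 := by
      ext k
      simp [Pi.single_apply, eq_comm]
    rw [he]
    rfl
  have hw : unactuatedCLM s m w = w ∘ Sum.inl := rfl
  simp [hJ, (hasFDerivAt_Mblk_mulVec hd q v i).fderiv, hw]

/-- Only the Jacobian contributes to the actuated components of the Coriolis force. -/
lemma Cvec_inr (hd : ∀ i j, Differentiable ℝ fun x => Mblk muu mau maa x i j)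
    (q v : Fin s ⊕ Fin m → ℝ) (k : Fin m) :
    Cvec muu mau maa q v (Sum.inr k) = (Jmat muu mau maa q v *ᵥ v) (Sum.inr k) := by
  have h0 : ((Jmat muu mau maa q v)ᵀ *ᵥ v) (Sum.inr k) = 0 := by
    rw [mulVec, dotProduct]
    exact Finset.sum_eq_zero fun j _ => by rw [transpose_apply, Jmat_inr hd, zero_mul]
  simp [Cvec, sub_mulVec, smul_mulVec, h0]

/-- Time derivative of the generalized momentum `M(q_u) q̇`. -/
lemma hasDerivWithinAt_momentum
    (hd : ∀ i j, Differentiable ℝ fun x => Mblk muu mau maa x i j)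
    {q qd : ℝ → Fin s ⊕ Fin m → ℝ} {a : Fin s ⊕ Fin m → ℝ} {S : Set ℝ} {t : ℝ}
    (hq : HasDerivWithinAt q (qd t) S t) (hqd : HasDerivWithinAt qd a S t)
    (i : Fin s ⊕ Fin m) :
    HasDerivWithinAt (fun t => (Mblk muu mau maa (q t ∘ Sum.inl) *ᵥ qd t) i)
      ((Mblk muu mau maa (q t ∘ Sum.inl) *ᵥ a) i
        + (Jmat muu mau maa (q t) (qd t) *ᵥ qd t) i) S t := by
  have hqu : HasDerivWithinAt (fun t => q t ∘ Sum.inl) (qd t ∘ Sum.inl) S t :=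
    (unactuatedCLM s m).hasFDerivAt.comp_hasDerivWithinAt t hq
  have hsum : HasDerivWithinAt (fun t => (Mblk muu mau maa (q t ∘ Sum.inl) *ᵥ qd t) i)
      (∑ j, (fderiv ℝ (fun x => Mblk muu mau maa x i j) (q t ∘ Sum.inl) (qd t ∘ Sum.inl) * qd t j
        + Mblk muu mau maa (q t ∘ Sum.inl) i j * a j)) S t := by
    simp only [mulVec, dotProduct]
    refine HasDerivWithinAt.fun_sum fun j _ => HasDerivWithinAt.mul ?_ ?_
    · exact (hd i j (q t ∘ Sum.inl)).hasFDerivAt.comp_hasDerivWithinAt t hqu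
    · exact hasDerivWithinAt_pi.1 hqd j
  refine hsum.congr_deriv ?_
  rw [Jmat_mulVec hd, mulVec, dotProduct, ← Finset.sum_add_distrib]
  exact Finset.sum_congr rfl fun j _ => by ring

end Blocks

lemma HasDerivWithinAt.dotProduct_self_mulVec {ι : Type*} [Fintype ι] {A : Matrix ι ι ℝ}
    (hA : A.IsSymm) {f : ℝ → ι → ℝ} {f' : ι → ℝ} {S : Set ℝ} {t : ℝ}
    (hf : HasDerivWithinAt f f' S t) :
    HasDerivWithinAt (fun t => f t ⬝ᵥ A *ᵥ f t) (2 * ((A *ᵥ f') ⬝ᵥ f t)) S t := by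
  have hAf : HasDerivWithinAt (fun t => A *ᵥ f t) (A *ᵥ f') S t :=
    (LinearMap.toContinuousLinearMap A.mulVecLin).hasFDerivAt.comp_hasDerivWithinAt t hf
  have hsum : HasDerivWithinAt (fun t => f t ⬝ᵥ A *ᵥ f t)
      (∑ i, (f' i * (A *ᵥ f t) i + f t i * (A *ᵥ f') i)) S t :=
    HasDerivWithinAt.fun_sum fun i _ =>
      (hasDerivWithinAt_pi.1 hf i).mul (hasDerivWithinAt_pi.1 hAf i)
  refine hsum.congr_deriv ?_
  have h := dotProduct_transpose_mulVec A f' (f t)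
  rw [hA.eq] at h
  rw [Finset.sum_add_distrib]
  change f' ⬝ᵥ A *ᵥ f t + f t ⬝ᵥ A *ᵥ f' = _
  rw [h, dotProduct_comm (A *ᵥ f')]
  ring

lemma continuous_grad {k : ℕ} {f : (Fin k → ℝ) → ℝ} {n : WithTop ℕ∞} (hf : ContDiff ℝ n f)
    (hn : n ≠ 0) : Continuous (grad f) :=
  continuous_pi fun _ => (hf.continuous_fderiv hn).clm_apply continuous_const

/-- Proposition 1, actuated output: along any trajectory with inner-loop
control `u = τ − ∇V_a(q_a)`, `d/dt H_a = uᵀ y_a`; since `M_a(q_u)` is positive semidefinite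
(so `H_a ≥ 0`), the map `u ↦ y_a` is passive with `∫₀ᵗ uᵀ y_a ≥ −H_a(q_u(0), q̇(0))`. -/
theorem prop1_actuated
    {s m : ℕ} (hs : 1 ≤ s) (hm : 1 ≤ m)
    (muu : (Fin s → ℝ) → Matrix (Fin s) (Fin s) ℝ)
    (mau : (Fin s → ℝ) → Matrix (Fin m) (Fin s) ℝ)
    (maa : Matrix (Fin m) (Fin m) ℝ)
    (hmuu : ∀ i j, ContDiff ℝ (⊤ : ℕ∞) fun x => muu x i j)
    (hmau : ∀ i j, ContDiff ℝ (⊤ : ℕ∞) fun x => mau x i j)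
    (hmaa : maa.IsSymm)
    (hM : ∀ qu, (Mblk muu mau maa qu).PosDef)
    (Vu : (Fin s → ℝ) → ℝ) (Va : (Fin m → ℝ) → ℝ)
    (hVu : ContDiff ℝ (⊤ : ℕ∞) Vu) (hVa : ContDiff ℝ (⊤ : ℕ∞) Va)
    (hVubdd : ∃ c : ℝ, ∀ x, c ≤ Vu x)
    (q qd qdd : ℝ → (Fin s ⊕ Fin m) → ℝ)
    (τ : ℝ → Fin m → ℝ) (hτ : ContinuousOn τ (Ici 0))
    (hq : ∀ t ∈ Ici (0:ℝ), HasDerivWithinAt q (qd t) (Ici 0) t)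
    (hqd : ∀ t ∈ Ici (0:ℝ), HasDerivWithinAt qd (qdd t) (Ici 0) t)
    (hqdd : ContinuousOn qdd (Ici 0))
    (hEL : ∀ t ∈ Ici (0:ℝ),
      Mblk muu mau maa (q t ∘ Sum.inl) *ᵥ qdd t
        + Cvec muu mau maa (q t) (qd t)
        + Sum.elim (grad Vu (q t ∘ Sum.inl)) (grad Va (q t ∘ Sum.inr))
      = Sum.elim (0 : Fin s → ℝ) (τ t))
 :
    (∀ qu : Fin s → ℝ, (MaMat mau maa qu).PosSemidef)
    ∧ (∀ t ∈ Ici (0:ℝ),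
      HasDerivWithinAt
        (fun t => Ha mau maa (q t ∘ Sum.inl) (qd t))
        ((τ t - grad Va (q t ∘ Sum.inr)) ⬝ᵥ
          yA mau maa (q t ∘ Sum.inl) (qd t ∘ Sum.inl) (qd t ∘ Sum.inr))
        (Ici 0) t)
    ∧ ∀ t ∈ Ici (0:ℝ),
        -(Ha mau maa (q 0 ∘ Sum.inl) (qd 0))
          ≤ ∫ σ in (0:ℝ)..t,
              (τ σ - grad Va (q σ ∘ Sum.inr)) ⬝ᵥ
                yA mau maa (q σ ∘ Sum.inl) (qd σ ∘ Sum.inl) (qd σ ∘ Sum.inr) := by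
  have hpos : maa.PosDef := posDef_of_Mblk_posDef (hM 0)
  have hdet : IsUnit maa.det := (isUnit_iff_isUnit_det _).1 hpos.isUnit
  have hd := differentiable_Mblk (maa := maa)
    (fun i j => (hmuu i j).differentiable (by simp))
    (fun i j => (hmau i j).differentiable (by simp))
  have hy : ∀ t ∈ Ici (0 : ℝ), HasDerivWithinAt
      (fun t => yA mau maa (q t ∘ Sum.inl) (qd t ∘ Sum.inl) (qd t ∘ Sum.inr))
      (maa⁻¹ *ᵥ (τ t - grad Va (q t ∘ Sum.inr))) (Ici 0) t := by
    intro t ht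
    have hp : HasDerivWithinAt
        (fun t i => (Mblk muu mau maa (q t ∘ Sum.inl) *ᵥ qd t) (Sum.inr i))
        (τ t - grad Va (q t ∘ Sum.inr)) (Ici 0) t := by
      refine hasDerivWithinAt_pi.2 fun i => ?_
      refine (hasDerivWithinAt_momentum hd (hq t ht) (hqd t ht) (Sum.inr i)).congr_deriv ?_
      have h := congrFun (hEL t ht) (Sum.inr i)
      simp only [Pi.add_apply, Sum.elim_inr, Cvec_inr hd] at h
      rw [Pi.sub_apply]
      linarith
    convert! (LinearMap.toContinuousLinearMap
      maa⁻¹.mulVecLin).hasFDerivAt.comp_hasDerivWithinAt t hp using 1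
    funext t
    change _ = maa⁻¹ *ᵥ fun i => (Mblk muu mau maa (q t ∘ Sum.inl) *ᵥ qd t) (Sum.inr i)
    rw [← mulVec_yA hdet, mulVec_mulVec, nonsing_inv_mul _ hdet, one_mulVec]
  have hH : ∀ t ∈ Ici (0 : ℝ), HasDerivWithinAt
      (fun t => Ha mau maa (q t ∘ Sum.inl) (qd t))
      ((τ t - grad Va (q t ∘ Sum.inr)) ⬝ᵥ
        yA mau maa (q t ∘ Sum.inl) (qd t ∘ Sum.inl) (qd t ∘ Sum.inr)) (Ici 0) t := by
    intro t ht
    simp only [Ha_eq_yA hmaa hdet]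
    refine (((hy t ht).dotProduct_self_mulVec hmaa).const_mul (1 / 2 : ℝ)).congr_deriv ?_
    rw [mulVec_mulVec, mul_nonsing_inv _ hdet, one_mulVec]
    ring
  refine ⟨MaMat_posSemidef hpos, hH, fun t ht => ?_⟩
  have hsub : Icc 0 t ⊆ Ici (0 : ℝ) := Icc_subset_Ici_self
  have hqcont : ContinuousOn q (Ici 0) := fun σ hσ => (hq σ hσ).continuousWithinAt
  have hycont : ContinuousOn
      (fun σ => yA mau maa (q σ ∘ Sum.inl) (qd σ ∘ Sum.inl) (qd σ ∘ Sum.inr)) (Ici 0) :=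
    fun σ hσ => (hy σ hσ).continuousWithinAt
  have hucont : ContinuousOn (fun σ => τ σ - grad Va (q σ ∘ Sum.inr)) (Ici 0) := by
    refine hτ.sub ((continuous_grad hVa (by simp)).comp_continuousOn ?_)
    exact continuousOn_pi.2 fun i => continuousOn_pi.1 hqcont (Sum.inr i)
  have hint : IntervalIntegrable (fun σ => (τ σ - grad Va (q σ ∘ Sum.inr)) ⬝ᵥ
      yA mau maa (q σ ∘ Sum.inl) (qd σ ∘ Sum.inl) (qd σ ∘ Sum.inr))
      MeasureTheory.volume 0 t := by
    refine ContinuousOn.intervalIntegrable_of_Icc ht (ContinuousOn.mono ?_ hsub)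
    exact continuousOn_finsetSum _ fun i _ =>
      (continuousOn_pi.1 hucont i).mul (continuousOn_pi.1 hycont i)
  rw [intervalIntegral.integral_eq_sub_of_hasDerivAt_of_le ht
    (fun σ hσ => ((hH σ (hsub hσ)).continuousWithinAt).mono hsub)
    (fun σ hσ => (hH σ hσ.1.le).hasDerivAt (Ici_mem_nhds hσ.1)) hint]
  linarith [Ha_nonneg (mau := mau) hpos (q t ∘ Sum.inl) (qd t)]
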